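/- Let (J^ℱ,(f_n)) and (J^𝒢,(g_n)) be two unimodal nonautonomous discrete dynamical systems with the same kneading sequence. Then for every n≥1 there exists a family of maps (h_n^k)_{k≥1} such that for every k≥1: h_n^k:𝒞_n^k(ℱ)→𝒞_n^k(𝒢) is a strictly increasing bijection (in particular the finite sets 𝒞_n^k(ℱ) and 𝒞_n^k(𝒢) have the same cardinality), h_n^k(c_n^ℱ)=c_n^𝒢, h_{n+1}^k(f_n(x))=g_n(h_n^k(x)) for all x∈𝒞_n^k(ℱ)∖{c_n^ℱ}, and h_n^{k+1} restricted to 𝒞_n^k(ℱ) equals h_n^k. -/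

import Mathlib

open Set

noncomputable section

/-- The nonautonomous iterate `f_n^ℓ = f_{n+ℓ-1} ∘ ⋯ ∘ f_n` (and `f_n^0 = id`). -/
def iterFrom (f : ℕ → ℝ → ℝ) : ℕ → ℕ → ℝ → ℝ
  | _, 0, x => x
  | n, ℓ + 1, x => f (n + ℓ) (iterFrom f n ℓ x)

/-- `(Icc a b, (f n))` is a unimodal nonautonomous discrete dynamical system with
turning points `c n`. -/
def IsUNDS (a b : ℝ) (f : ℕ → ℝ → ℝ) (c : ℕ → ℝ) : Prop :=
  a < b ∧ ∀ n : ℕ,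
    ContinuousOn (f n) (Icc a b) ∧
    MapsTo (f n) (Icc a b) (Icc a b) ∧
    f n a = a ∧ f n b = a ∧
    c n ∈ Ioo a b ∧
    StrictMonoOn (f n) (Icc a (c n)) ∧
    StrictAntiOn (f n) (Icc (c n) b)

/-- The two systems have the same kneading sequence (`𝕍(ℱ) = 𝕍(𝒢)`). -/
def SameKneading (f : ℕ → ℝ → ℝ) (cF : ℕ → ℝ) (g : ℕ → ℝ → ℝ) (cG : ℕ → ℝ) : Prop :=
  ∀ n ℓ : ℕ,
    (iterFrom f n ℓ (cF n) < cF (n + ℓ) ↔ iterFrom g n ℓ (cG n) < cG (n + ℓ)) ∧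
    (iterFrom f n ℓ (cF n) = cF (n + ℓ) ↔ iterFrom g n ℓ (cG n) = cG (n + ℓ))

/-- `𝒞_n(ℱ)`: points of `Icc a b` eventually mapped onto a turning point. -/
def critSet (a b : ℝ) (f : ℕ → ℝ → ℝ) (c : ℕ → ℝ) (n : ℕ) : Set ℝ :=
  {x ∈ Icc a b | ∃ ℓ : ℕ, iterFrom f n ℓ x = c (n + ℓ)}


/-- `𝒞_n^k(ℱ)`: points of `Icc a b` mapped onto a turning point within the first
`k` levels (`0 ≤ ℓ ≤ k-1`). -/
def critSetK (a b : ℝ) (f : ℕ → ℝ → ℝ) (c : ℕ → ℝ) (n k : ℕ) : Set ℝ :=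
  {x ∈ Icc a b | ∃ ℓ < k, iterFrom f n ℓ x = c (n + ℓ)}

theorem iterFrom_succ' (f : ℕ → ℝ → ℝ) (n ℓ : ℕ) (x : ℝ) :
    iterFrom f n (ℓ + 1) x = iterFrom f (n + 1) ℓ (f n x) := by
  induction ℓ with
  | zero => rfl
  | succ ℓ ih =>
    rw [iterFrom, ih, iterFrom, Nat.add_right_comm n 1 ℓ, Nat.add_assoc]

theorem mem_critSetK_succ {a b : ℝ} {f : ℕ → ℝ → ℝ} {c : ℕ → ℝ} (h : IsUNDS a b f c)
    {n k : ℕ} {x : ℝ} :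
    x ∈ critSetK a b f c n (k + 1) ↔
      x ∈ Icc a b ∧ (x = c n ∨ f n x ∈ critSetK a b f c (n + 1) k) := by
  refine and_congr_right fun hx => ?_
  constructor
  · rintro ⟨ℓ, hℓ, e⟩
    cases ℓ with
    | zero => exact Or.inl e
    | succ ℓ =>
      refine Or.inr ⟨(h.2 n).2.1 hx, ℓ, by omega, ?_⟩
      rw [← iterFrom_succ', e, Nat.add_right_comm n 1 ℓ, Nat.add_assoc]
  · rintro (e | ⟨-, ℓ, hℓ, e⟩)
    · exact ⟨0, by omega, e⟩
    · refine ⟨ℓ + 1, by omega, ?_⟩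
      rw [iterFrom_succ', e, Nat.add_right_comm n 1 ℓ, Nat.add_assoc]

theorem critSetK_finite {a b : ℝ} {f : ℕ → ℝ → ℝ} {c : ℕ → ℝ} (h : IsUNDS a b f c)
    (n k : ℕ) : (critSetK a b f c n k).Finite := by
  induction k generalizing n with
  | zero => exact finite_empty.subset fun x hx => by obtain ⟨-, ℓ, hℓ, -⟩ := hx; omega
  | succ k ih =>
    obtain ⟨-, -, -, -, -, hmono, hanti⟩ := h.2 n
    have hl : (Icc a (c n) ∩ f n ⁻¹' critSetK a b f c (n + 1) k).Finite :=
      Finite.of_finite_image ((ih (n + 1)).subset (by rintro _ ⟨x, hx, rfl⟩; exact hx.2))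
        (hmono.injOn.mono inter_subset_left)
    have hr : (Icc (c n) b ∩ f n ⁻¹' critSetK a b f c (n + 1) k).Finite :=
      Finite.of_finite_image ((ih (n + 1)).subset (by rintro _ ⟨x, hx, rfl⟩; exact hx.2))
        (hanti.injOn.mono inter_subset_left)
    refine ((finite_singleton (c n)).union (hl.union hr)).subset fun x hx => ?_
    obtain ⟨hx, e | hfx⟩ := (mem_critSetK_succ h).1 hx
    · exact Or.inl e
    · rcases le_total x (c n) with hc | hc
      · exact Or.inr (Or.inl ⟨⟨hx.1, hc⟩, hfx⟩)
      · exact Or.inr (Or.inr ⟨⟨hc, hx.2⟩, hfx⟩)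

/-- The maximum of `f n` is attained only at the turning point. -/
theorem IsUNDS.apply_lt_apply_turning {a b : ℝ} {f : ℕ → ℝ → ℝ} {c : ℕ → ℝ}
    (h : IsUNDS a b f c) {n : ℕ} {x : ℝ} (hx : x ∈ Icc a b) (hne : x ≠ c n) :
    f n x < f n (c n) := by
  obtain ⟨-, -, -, -, hc, hmono, hanti⟩ := h.2 n
  rcases hne.lt_or_gt with hlt | hlt
  · exact hmono ⟨hx.1, hlt.le⟩ (right_mem_Icc.2 hc.1.le) hlt
  · exact hanti (left_mem_Icc.2 hc.2.le) ⟨hlt.le, hx.2⟩ hlt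

/-- The itineraries of `x` under `f` and of `y` under `g`, both started at time `n`, coincide. -/
def SameItinerary (f : ℕ → ℝ → ℝ) (cF : ℕ → ℝ) (g : ℕ → ℝ → ℝ) (cG : ℕ → ℝ) (n : ℕ)
    (x y : ℝ) : Prop :=
  ∀ ℓ : ℕ,
    (iterFrom f n ℓ x < cF (n + ℓ) ↔ iterFrom g n ℓ y < cG (n + ℓ)) ∧
    (iterFrom f n ℓ x = cF (n + ℓ) ↔ iterFrom g n ℓ y = cG (n + ℓ))

section

variable {aF bF aG bG : ℝ} {f g : ℕ → ℝ → ℝ} {cF cG : ℕ → ℝ} {n : ℕ} {x y x' y' : ℝ}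

theorem sameItinerary_iff :
    SameItinerary f cF g cG n x y ↔
      ((x < cF n ↔ y < cG n) ∧ (x = cF n ↔ y = cG n)) ∧
        SameItinerary f cF g cG (n + 1) (f n x) (g n y) := by
  have key : ∀ ℓ, n + 1 + ℓ = n + (ℓ + 1) := fun ℓ => by omega
  constructor
  · intro h
    refine ⟨h 0, fun ℓ => ?_⟩
    rw [← iterFrom_succ', ← iterFrom_succ', key]
    exact h (ℓ + 1)
  · rintro ⟨h0, h⟩ ℓ
    cases ℓ with
    | zero => exact h0
    | succ ℓ =>
      rw [iterFrom_succ', iterFrom_succ', ← key ℓ]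
      exact h ℓ

theorem SameItinerary.symm (h : SameItinerary f cF g cG n x y) :
    SameItinerary g cG f cF n y x :=
  fun ℓ => ⟨(h ℓ).1.symm, (h ℓ).2.symm⟩

theorem SameItinerary.mem_critSetK {k : ℕ} (h : SameItinerary f cF g cG n x y)
    (hx : x ∈ critSetK aF bF f cF n k) (hy : y ∈ Icc aG bG) : y ∈ critSetK aG bG g cG n k := by
  obtain ⟨-, ℓ, hℓ, e⟩ := hx
  exact ⟨hy, ℓ, hℓ, (h ℓ).2.1 e⟩

/-- Matching itineraries determine the relative order with respect to precritical points. -/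
theorem SameItinerary.compare (hF : IsUNDS aF bF f cF) (hG : IsUNDS aG bG g cG) {k : ℕ}
    (hx : x ∈ critSetK aF bF f cF n k) (hx' : x' ∈ Icc aF bF)
    (hy : y ∈ Icc aG bG) (hy' : y' ∈ Icc aG bG)
    (h : SameItinerary f cF g cG n x y) (h' : SameItinerary f cF g cG n x' y') :
    (x < x' ↔ y < y') ∧ (x = x' ↔ y = y') := by
  induction k generalizing n x y x' y' with
  | zero => obtain ⟨-, ℓ, hℓ, -⟩ := hx; omega
  | succ k ih =>
    obtain ⟨hxI, hx⟩ := (mem_critSetK_succ hF).1 hx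
    obtain ⟨⟨hlt, heq⟩, hs⟩ := sameItinerary_iff.1 h
    obtain ⟨⟨hlt', heq'⟩, hs'⟩ := sameItinerary_iff.1 h'
    by_cases hxc : x = cF n
    · have hyc := heq.1 hxc
      grind
    · obtain ⟨-, hFm, -, -, -, hFmono, hFanti⟩ := hF.2 n
      obtain ⟨-, hGm, -, -, -, hGmono, hGanti⟩ := hG.2 n
      have hyc : y ≠ cG n := fun e => hxc (heq.2 e)
      obtain ⟨ilt, ieq⟩ :=
        ih (hx.resolve_left hxc) (hFm hx') (hGm hy) (hGm hy') hs hs'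
      rcases lt_or_ge x (cF n) with h1 | h1 <;> rcases lt_or_ge x' (cF n) with h2 | h2
      · have e1 : x ∈ Icc aF (cF n) := ⟨hxI.1, h1.le⟩
        have e2 : x' ∈ Icc aF (cF n) := ⟨hx'.1, h2.le⟩
        have e3 : y ∈ Icc aG (cG n) := ⟨hy.1, (hlt.1 h1).le⟩
        have e4 : y' ∈ Icc aG (cG n) := ⟨hy'.1, (hlt'.1 h2).le⟩
        rw [hFmono.lt_iff_lt e1 e2, hGmono.lt_iff_lt e3 e4] at ilt
        rw [hFmono.injOn.eq_iff e1 e2, hGmono.injOn.eq_iff e3 e4] at ieq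
        exact ⟨ilt, ieq⟩
      · grind
      · grind
      · have g1 : cG n ≤ y := not_lt.1 fun e => h1.not_gt (hlt.2 e)
        have g2 : cG n ≤ y' := not_lt.1 fun e => h2.not_gt (hlt'.2 e)
        have e1 : x ∈ Icc (cF n) bF := ⟨h1, hxI.2⟩
        have e2 : x' ∈ Icc (cF n) bF := ⟨h2, hx'.2⟩
        have e3 : y ∈ Icc (cG n) bG := ⟨g1, hy.2⟩
        have e4 : y' ∈ Icc (cG n) bG := ⟨g2, hy'.2⟩
        have e := hFanti.lt_iff_gt e1 e2
        have e' := hGanti.lt_iff_gt e3 e4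
        have i := hFanti.injOn.eq_iff e1 e2
        have i' := hGanti.injOn.eq_iff e3 e4
        grind

theorem SameKneading.symm (h : SameKneading f cF g cG) : SameKneading g cG f cF :=
  fun n ℓ => ⟨(h n ℓ).1.symm, (h n ℓ).2.symm⟩

theorem SameKneading.sameItinerary (h : SameKneading f cF g cG) (n : ℕ) :
    SameItinerary f cF g cG n (cF n) (cG n) :=
  h n

/-- Every precritical point of one system has a counterpart with the same itinerary in the other. -/
theorem SameKneading.exists_sameItinerary (hF : IsUNDS aF bF f cF) (hG : IsUNDS aG bG g cG)
    (hknead : SameKneading f cF g cG) {k : ℕ} (hx : x ∈ critSetK aF bF f cF n k) :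
    ∃ y ∈ Icc aG bG, SameItinerary f cF g cG n x y := by
  induction k generalizing n x with
  | zero => obtain ⟨-, ℓ, hℓ, -⟩ := hx; omega
  | succ k ih =>
    obtain ⟨hxI, hx⟩ := (mem_critSetK_succ hF).1 hx
    obtain ⟨-, hFm, -, -, hcF, -, -⟩ := hF.2 n
    obtain ⟨hcont, hGm, hga, hgb, hcG, -, -⟩ := hG.2 n
    have hcFI := Ioo_subset_Icc_self hcF
    have hcGI := Ioo_subset_Icc_self hcG
    by_cases hxc : x = cF n
    · subst hxc
      exact ⟨cG n, hcGI, hknead.sameItinerary n⟩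
    · have hfx := hx.resolve_left hxc
      obtain ⟨z, hz, hs⟩ := ih hfx
      have hzc : z < g n (cG n) :=
        (hs.compare hF hG hfx (hFm hcFI) hz (hGm hcGI)
          (sameItinerary_iff.1 (hknead.sameItinerary n)).2).1.1
          (hF.apply_lt_apply_turning hxI hxc)
      rcases Ne.lt_or_gt hxc with hlt | hlt
      · obtain ⟨y, hy, rfl⟩ := intermediate_value_Icc hcG.1.le
          (hcont.mono (Icc_subset_Icc_right hcG.2.le)) ⟨hga.le.trans hz.1, hzc.le⟩
        have hyc : y < cG n := lt_of_le_of_ne hy.2 fun e => hzc.ne (by rw [e])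
        exact ⟨y, ⟨hy.1, hy.2.trans hcG.2.le⟩, sameItinerary_iff.2
          ⟨⟨iff_of_true hlt hyc, iff_of_false hlt.ne hyc.ne⟩, hs⟩⟩
      · obtain ⟨y, hy, rfl⟩ := intermediate_value_Icc' hcG.2.le
          (hcont.mono (Icc_subset_Icc_left hcG.1.le)) ⟨hgb.le.trans hz.1, hzc.le⟩
        have hyc : cG n < y := lt_of_le_of_ne hy.1 fun e => hzc.ne (by rw [e])
        exact ⟨y, ⟨hcG.1.le.trans hy.1, hy.2⟩, sameItinerary_iff.2
          ⟨⟨iff_of_false hlt.not_gt hyc.not_gt, iff_of_false hlt.ne' hyc.ne'⟩, hs⟩⟩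

end

/-- If two UNDS have the same kneading sequence, then for every `n` there is a family
of strictly increasing bijections `H n k : 𝒞_n^k(ℱ) → 𝒞_n^k(𝒢)` (so the finite sets
`𝒞_n^k(ℱ)` and `𝒞_n^k(𝒢)` have the same cardinality), sending `c_n^ℱ` to `c_n^𝒢`,
intertwining the dynamics away from the turning point, and compatible as `k` grows. -/
theorem exists_finite_level_bijections
    (aF bF aG bG : ℝ) (f g : ℕ → ℝ → ℝ) (cF cG : ℕ → ℝ)
    (hF : IsUNDS aF bF f cF) (hG : IsUNDS aG bG g cG)
    (hknead : SameKneading f cF g cG) :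
    ∃ H : ℕ → ℕ → ℝ → ℝ, ∀ n : ℕ, ∀ k : ℕ, 1 ≤ k →
      (critSetK aF bF f cF n k).Finite ∧
      (critSetK aG bG g cG n k).Finite ∧
      (critSetK aF bF f cF n k).ncard = (critSetK aG bG g cG n k).ncard ∧
      StrictMonoOn (H n k) (critSetK aF bF f cF n k) ∧
      BijOn (H n k) (critSetK aF bF f cF n k) (critSetK aG bG g cG n k) ∧
      H n k (cF n) = cG n ∧
      (∀ x ∈ critSetK aF bF f cF n k \ {cF n}, H (n + 1) k (f n x) = g n (H n k x)) ∧
      (∀ x ∈ critSetK aF bF f cF n k, H n (k + 1) x = H n k x) := by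
  have hex : ∀ n x, ∃ y, ∀ k, x ∈ critSetK aF bF f cF n k →
      y ∈ Icc aG bG ∧ SameItinerary f cF g cG n x y := by
    intro n x
    by_cases hx : ∃ k, x ∈ critSetK aF bF f cF n k
    · obtain ⟨k, hk⟩ := hx
      obtain ⟨y, hy⟩ := hknead.exists_sameItinerary hF hG hk
      exact ⟨y, fun _ _ => hy⟩
    · exact ⟨0, fun k hk => absurd ⟨k, hk⟩ hx⟩
  choose H hH using hex
  have huniq : ∀ {n k x y}, x ∈ critSetK aF bF f cF n k → y ∈ Icc aG bG →
      SameItinerary f cF g cG n x y → H n x = y := fun hx hy h =>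
    ((hH _ _ _ hx).2.compare hF hG hx hx.1 (hH _ _ _ hx).1 hy h).2.1 rfl
  refine ⟨fun n _ => H n, fun n k hk => ?_⟩
  have hmono : StrictMonoOn (H n) (critSetK aF bF f cF n k) := fun x hx x' hx' hlt =>
    ((hH _ _ _ hx).2.compare hF hG hx hx'.1 (hH _ _ _ hx).1 (hH _ _ _ hx').1
      (hH _ _ _ hx').2).1.1 hlt
  have hbij : BijOn (H n) (critSetK aF bF f cF n k) (critSetK aG bG g cG n k) := by
    refine ⟨fun x hx => (hH _ _ _ hx).2.mem_critSetK hx (hH _ _ _ hx).1, hmono.injOn,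
      fun y hy => ?_⟩
    obtain ⟨x, hxI, hs⟩ := hknead.symm.exists_sameItinerary hG hF hy
    have hx := hs.mem_critSetK hy hxI
    exact ⟨x, hx, huniq hx hy.1 hs.symm⟩
  refine ⟨critSetK_finite hF n k, critSetK_finite hG n k, ?_, hmono, hbij, ?_, ?_,
    fun _ _ => rfl⟩
  · rw [← hbij.image_eq, hbij.injOn.ncard_image]
  · exact huniq (k := k) ⟨Ioo_subset_Icc_self (hF.2 n).2.2.2.2.1, 0, hk, rfl⟩
      (Ioo_subset_Icc_self (hG.2 n).2.2.2.2.1) (hknead.sameItinerary n)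
  · rintro x ⟨hx, hxc⟩
    obtain ⟨hy, hs⟩ := hH _ _ _ hx
    obtain ⟨k, rfl⟩ := Nat.exists_eq_add_of_le' hk
    have hfx := ((mem_critSetK_succ hF).1 hx).2.resolve_left hxc
    exact huniq hfx ((hG.2 n).2.1 hy) (sameItinerary_iff.1 hs).2
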